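/- Let q ≥ 2, C ≥ 1, let d ≥ 3 be an integer, let α, ε ∈ (0,1], let L ≥ 1, and set Π := 2^113 · q^10 · C^2 · d^24 · L^8 / (α^14 · ε^18). Let G be a d-regular simple graph on [n] that satisfies the long-range expansion property Expan(α,ε,L), let k ≥ 1, and let ‖·‖_X be a 1-unconditional norm on ℝ^k. Let f : [n] → {−1,0,1}^k be a non-identically-zero map such that min{|{v ∈ [n] : f(v)_j ≥ 0}|, |{v ∈ [n] : f(v)_j ≤ 0}|} ≥ n/2 for every j ∈ [k], and such that the collection of vectors {P_J(|f(v)|) : v ∈ [n], J ⊆ [k]} has restricted cotype q with constant C with respect to ‖·‖_X. Then ∑_{v∈[n]} ‖f(v)‖_X ≤ Π · ∑_{{w,w'}∈E_G} ‖f(w)−f(w')‖_X. -/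

import Mathlib

open Finset

attribute [local instance] Classical.propDecidable

noncomputable section

/-- Distance (in `ℕ∞`) from a vertex to a finite set of vertices. -/
def vertexSetDist {n : ℕ} (G : SimpleGraph (Fin n)) (v : Fin n) (S : Finset (Fin n)) : ℕ∞ :=
  S.inf fun w => G.edist v w

/-- Distance (in `ℕ∞`) from a vertex to an (unordered) edge. -/
def edgeDist {n : ℕ} (G : SimpleGraph (Fin n)) (v : Fin n) (e : Sym2 (Fin n)) : ℕ∞ :=
  Sym2.lift ⟨fun a b => min (G.edist v a) (G.edist v b), fun _ _ => min_comm _ _⟩ e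

/-- Distance (in `ℕ∞`) from an (unordered) edge to a finite set of vertices. -/
def edgeSetDist {n : ℕ} (G : SimpleGraph (Fin n)) (e : Sym2 (Fin n)) (S : Finset (Fin n)) : ℕ∞ :=
  S.inf fun v => edgeDist G v e

/-- Part (A) of the long-range expansion property. -/
def ExpanA (n d : ℕ) (G : SimpleGraph (Fin n)) (α : ℝ) : Prop :=
  ∀ S : Finset (Fin n), S.Nonempty → ∀ ℓ : ℕ, 1 ≤ ℓ →
    min (3 * (n : ℝ) / 4) (α * ((d : ℝ) - 1) ^ ℓ * S.card) ≤
      ((univ.filter fun v => vertexSetDist G v S ≤ (ℓ : ℕ∞)).card : ℝ)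

/-- Part (B) of the long-range expansion property. -/
def ExpanB (n d : ℕ) (G : SimpleGraph (Fin n)) [DecidableRel G.Adj] (α ε L : ℝ) : Prop :=
  ∀ S : Finset (Fin n), S.Nonempty → ∀ ℓ : ℕ, 1 ≤ ℓ →
    α * ((d : ℝ) - 1) ^ (ℓ - 1) * S.card ≤ 3 * n / 4 →
    ∃ v ∈ S,
      (((G.edgeFinset.filter fun e =>
            L * ((d : ℝ) - 1 - ε) ^ ℓ ≤
              ((S.filter fun u => edgeDist G u e ≤ ((ℓ - 1 : ℕ) : ℕ∞)).card : ℝ)).filter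
          fun e => edgeDist G v e ≤ ((ℓ - 1 : ℕ) : ℕ∞)).card : ℝ) ≤
        L * ((d : ℝ) - 1 - ε) ^ ℓ

/-- The long-range expansion property `Expan(α, ε, L)`. -/
def Expan (n d : ℕ) (G : SimpleGraph (Fin n)) [DecidableRel G.Adj] (α ε L : ℝ) : Prop :=
  ExpanA n d G α ∧ ExpanB n d G α ε L

/-- `N` is a norm on `ℝ^k`. -/
def IsNorm (k : ℕ) (N : (Fin k → ℝ) → ℝ) : Prop :=
  (∀ x, N x = 0 ↔ x = 0) ∧ (∀ (c : ℝ) (x), N (c • x) = |c| * N x) ∧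
    ∀ x y, N (x + y) ≤ N x + N y

/-- The standard basis of `ℝ^k` is `K`-unconditional for `N`. -/
def UncondConst (k : ℕ) (N : (Fin k → ℝ) → ℝ) (K : ℝ) : Prop :=
  ∀ (σ : Fin k → Bool) (a : Fin k → ℝ),
    N (fun j => (if σ j then (1 : ℝ) else -1) * a j) ≤ K * N a

/-- `N` is a `1`-unconditional norm on `ℝ^k`: `‖y‖ = ‖|y|‖`. -/
def OneUnconditional (k : ℕ) (N : (Fin k → ℝ) → ℝ) : Prop :=
  ∀ y, N y = N fun j => |y j|

/-- `N` has cotype `q` with constant `C`. -/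
def HasCotype (k : ℕ) (N : (Fin k → ℝ) → ℝ) (q C : ℝ) : Prop :=
  ∀ (m : ℕ) (x : Fin m → Fin k → ℝ),
    1 / C ^ q * ∑ i, N (x i) ^ q ≤
      1 / 2 ^ m * ∑ σ : Fin m → Bool, N (∑ i, (if σ i then (1 : ℝ) else -1) • x i) ^ q

/-- The collection of vectors `Y` has restricted cotype `q` with constant `C` w.r.t. `N`. -/
def RestrictedCotype (k : ℕ) (N : (Fin k → ℝ) → ℝ) (q C : ℝ) (Y : Set (Fin k → ℝ)) : Prop :=
  ∀ (m : ℕ), 0 < m → ∀ y : Fin m → Fin k → ℝ, Function.Injective y → (∀ i, y i ∈ Y) →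
    1 / C ^ q * ∑ i, N (y i) ^ q ≤
      1 / 2 ^ m * ∑ σ : Fin m → Bool, N (∑ i, (if σ i then (1 : ℝ) else -1) • y i) ^ q

/-- For an edge `e = {a, b}`, the value `N (f a - f b)` (well-defined when `N` is a norm). -/
def edgeNorm {n k : ℕ} (N : (Fin k → ℝ) → ℝ) (f : Fin n → Fin k → ℝ) (e : Sym2 (Fin n)) : ℝ :=
  Sym2.lift ⟨fun a b => min (N (f a - f b)) (N (f b - f a)), fun _ _ => min_comm _ _⟩ e

/-- Coordinate projection `P_J`. -/
def proj {k : ℕ} (J : Finset (Fin k)) (y : Fin k → ℝ) : Fin k → ℝ :=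
  fun j => if j ∈ J then y j else 0

/-- Indicator vector `χ_J ∈ ℝ^k`. -/
def chi {k : ℕ} (J : Finset (Fin k)) : Fin k → ℝ := fun j => if j ∈ J then 1 else 0

/-- The sequence `a_ℓ = (6/π²) ℓ⁻²`. -/
def aseq (ℓ : ℕ) : ℝ := 6 / Real.pi ^ 2 * (1 / (ℓ : ℝ) ^ 2)

/-- The set of edges `E(S, j; ℓ)`: edges within distance `ℓ - 1` of `S` with a jump in the
`j`-th coordinate. -/
def jumpEdges {n k : ℕ} (G : SimpleGraph (Fin n)) [DecidableRel G.Adj]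
    (f : Fin n → Fin k → ℝ) (j : Fin k) (S : Finset (Fin n)) (ℓ : ℕ) :
    Finset (Sym2 (Fin n)) :=
  G.edgeFinset.filter fun e =>
    edgeSetDist G e S ≤ ((ℓ - 1 : ℕ) : ℕ∞) ∧
      Sym2.lift ⟨fun a b => f a j ≠ f b j, fun _ _ => propext ne_comm⟩ e

/-- The scale `ℓ_{v,j}`. -/
def lvj {n k : ℕ} (G : SimpleGraph (Fin n)) [DecidableRel G.Adj]
    (f : Fin n → Fin k → ℝ) (α : ℝ) (d : ℕ) (v : Fin n) (j : Fin k) : ℕ :=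
  sInf {ℓ : ℕ | 1 ≤ ℓ ∧
    α * aseq ℓ / 6 * ((d : ℝ) - 1) ^ (ℓ - 1) ≤ ((jumpEdges G f j {v} ℓ).card : ℝ)}

/-- The set `V_+(j; ℓ)`. -/
def Vplus {n k : ℕ} (G : SimpleGraph (Fin n)) [DecidableRel G.Adj]
    (f : Fin n → Fin k → ℝ) (α : ℝ) (d : ℕ) (j : Fin k) (ℓ : ℕ) : Finset (Fin n) :=
  univ.filter fun v => f v j = 1 ∧ lvj G f α d v j = ℓ

/-- The set `V_-(j; ℓ)`. -/
def Vminus {n k : ℕ} (G : SimpleGraph (Fin n)) [DecidableRel G.Adj]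
    (f : Fin n → Fin k → ℝ) (α : ℝ) (d : ℕ) (j : Fin k) (ℓ : ℕ) : Finset (Fin n) :=
  univ.filter fun v => f v j = -1 ∧ lvj G f α d v j = ℓ

/-- The scale-`ℓ` support `J(v, ℓ)`. -/
def Jset {n k : ℕ} (G : SimpleGraph (Fin n)) [DecidableRel G.Adj]
    (f : Fin n → Fin k → ℝ) (α : ℝ) (d : ℕ) (v : Fin n) (ℓ : ℕ) : Finset (Fin k) :=
  univ.filter fun j => f v j ≠ 0 ∧ lvj G f α d v j = ℓ

/-- The scale-`ℓ` mutual support `J(v, ℓ, e)`, relative to a family `Ẽ(v, j)` of edge sets. -/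
def JsetE {n k : ℕ} (G : SimpleGraph (Fin n)) [DecidableRel G.Adj]
    (f : Fin n → Fin k → ℝ) (α : ℝ) (d : ℕ) (Et : Fin n → Fin k → Finset (Sym2 (Fin n)))
    (v : Fin n) (ℓ : ℕ) (e : Sym2 (Fin n)) : Finset (Fin k) :=
  (Jset G f α d v ℓ).filter fun j => e ∈ Et v j

end

theorem aux_edist_le_iff {n : ℕ} (G : SimpleGraph (Fin n)) (u v : Fin n) (r : ℕ) :
    G.edist u v ≤ (r : ℕ∞) ↔ ∃ p : G.Walk u v, p.length ≤ r := by
  constructor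
  · intro h
    have hne : G.edist u v ≠ ⊤ := by
      intro h'
      rw [h'] at h
      exact absurd h (by simp)
    obtain ⟨p, hp⟩ := SimpleGraph.exists_walk_of_edist_ne_top hne
    refine ⟨p, ?_⟩
    rw [← hp] at h
    exact_mod_cast h
  · rintro ⟨p, hp⟩
    exact (SimpleGraph.edist_le p).trans (by exact_mod_cast hp)

theorem aux_edgeDist_mk {n : ℕ} (G : SimpleGraph (Fin n)) (v a b : Fin n) :
    edgeDist G v s(a, b) = min (G.edist v a) (G.edist v b) := rfl

theorem aux_edgeDist_adj {n : ℕ} (G : SimpleGraph (Fin n)) (u w : Fin n) (h : G.Adj u w)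
    (e : Sym2 (Fin n)) : edgeDist G u e ≤ edgeDist G w e + 1 := by
  induction e with
  | _ a b =>
    rw [aux_edgeDist_mk, aux_edgeDist_mk]
    have h1 : G.edist u w = 1 := SimpleGraph.edist_eq_one_iff_adj.2 h
    have ha : G.edist u a ≤ G.edist w a + 1 := by
      have := SimpleGraph.edist_triangle (G := G) (u := u) (v := w) (w := a)
      rw [h1, add_comm] at this; exact this
    have hb : G.edist u b ≤ G.edist w b + 1 := by
      have := SimpleGraph.edist_triangle (G := G) (u := u) (v := w) (w := b)
      rw [h1, add_comm] at this; exact this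
    rcases le_total (G.edist w a) (G.edist w b) with h' | h'
    · rw [min_eq_left h']; exact (min_le_left _ _).trans ha
    · rw [min_eq_right h']; exact (min_le_right _ _).trans hb

theorem aux_edgeDist_pred {n : ℕ} (G : SimpleGraph (Fin n)) (u : Fin n)
    (e : Sym2 (Fin n)) (r : ℕ) (h : edgeDist G u e = ((r + 1 : ℕ) : ℕ∞)) :
    ∃ w, G.Adj u w ∧ edgeDist G w e ≤ (r : ℕ∞) := by
  induction e with
  | _ a b =>
    rw [aux_edgeDist_mk] at h
    have key : ∀ c, G.edist u c = ((r + 1 : ℕ) : ℕ∞) →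
        ∃ w, G.Adj u w ∧ G.edist w c ≤ (r : ℕ∞) := by
      intro c hc
      obtain ⟨p, hp⟩ := SimpleGraph.exists_walk_of_edist_eq_coe hc
      cases p with
      | nil => simp at hp
      | cons h' p' =>
        refine ⟨_, h', (aux_edist_le_iff G _ _ _).2 ⟨p', ?_⟩⟩
        simp at hp; omega
    rcases le_total (G.edist u a) (G.edist u b) with h' | h'
    · rw [min_eq_left h'] at h
      obtain ⟨w, hw, hw'⟩ := key a h
      exact ⟨w, hw, by rw [aux_edgeDist_mk]; exact (min_le_left _ _).trans hw'⟩
    · rw [min_eq_right h'] at h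
      obtain ⟨w, hw, hw'⟩ := key b h
      exact ⟨w, hw, by rw [aux_edgeDist_mk]; exact (min_le_right _ _).trans hw'⟩

theorem aux_edgeDist_zero {n : ℕ} (G : SimpleGraph (Fin n)) (v a b : Fin n) :
    edgeDist G v s(a, b) = 0 ↔ v = a ∨ v = b := by
  rw [aux_edgeDist_mk, ← SimpleGraph.edist_eq_zero_iff (G := G),
    ← SimpleGraph.edist_eq_zero_iff (G := G)]
  rcases le_total (G.edist v a) (G.edist v b) with h' | h'
  · rw [min_eq_left h']
    constructor
    · exact Or.inl
    · rintro (h | h)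
      · exact h
      · rw [h] at h'; exact le_antisymm h' zero_le
  · rw [min_eq_right h']
    constructor
    · exact Or.inr
    · rintro (h | h)
      · rw [h] at h'; exact le_antisymm h' zero_le
      · exact h

theorem aux_sphere {n d : ℕ} (hd : 3 ≤ d) (G : SimpleGraph (Fin n)) [DecidableRel G.Adj]
    (hreg : ∀ v, G.degree v = d) (e : Sym2 (Fin n)) (he : e ∈ G.edgeFinset) (r : ℕ) :
    (univ.filter fun v => edgeDist G v e = (r : ℕ∞)).card ≤ 2 * (d - 1) ^ r := by
  induction r with
  | zero =>
    induction e with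
    | _ a b =>
      have : (univ.filter fun v => edgeDist G v s(a, b) = ((0 : ℕ) : ℕ∞)) ⊆ {a, b} := by
        intro v hv
        have := (aux_edgeDist_zero G v a b).1 (by simpa using hv)
        simpa using this
      simpa using (card_le_card this).trans card_le_two
  | succ r ih =>
    have hsub : (univ.filter fun v => edgeDist G v e = ((r + 1 : ℕ) : ℕ∞)) ⊆
        (univ.filter fun v => edgeDist G v e = (r : ℕ∞)).biUnion
          (fun w => (G.neighborFinset w).filter
            fun u => edgeDist G u e = ((r + 1 : ℕ) : ℕ∞)) := by
      intro u hu
      have hu' : edgeDist G u e = ((r + 1 : ℕ) : ℕ∞) := by simpa using hu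
      obtain ⟨w, hw, hwr⟩ := aux_edgeDist_pred G u e r hu'
      have h2 := aux_edgeDist_adj G u w hw e
      have h3 : edgeDist G w e = (r : ℕ∞) := by
        obtain ⟨x, hx⟩ := ENat.ne_top_iff_exists.1 (ne_top_of_le_ne_top (by simp) hwr)
        rw [← hx] at h2 hwr ⊢
        rw [hu'] at h2
        have h2' : r + 1 ≤ x + 1 := by exact_mod_cast h2
        have h1' : x ≤ r := by exact_mod_cast hwr
        have : x = r := by omega
        rw [this]
      rw [mem_biUnion]
      refine ⟨w, by simpa using h3, ?_⟩
      rw [mem_filter, SimpleGraph.mem_neighborFinset]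
      exact ⟨hw.symm, hu'⟩
    have hcard : ∀ w ∈ (univ.filter fun v => edgeDist G v e = (r : ℕ∞)),
        ((G.neighborFinset w).filter
            fun u => edgeDist G u e = ((r + 1 : ℕ) : ℕ∞)).card ≤ d - 1 := by
      intro w hw
      have hw' : edgeDist G w e = (r : ℕ∞) := by simpa using hw
      have hex : ∃ u, G.Adj w u ∧ edgeDist G u e ≤ (r : ℕ∞) := by
        cases r with
        | zero =>
          induction e with
          | _ a b =>
            have hab : G.Adj a b := by simpa using he
            rcases (aux_edgeDist_zero G w a b).1 (by simpa using hw') with h | h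
            · refine ⟨b, h ▸ hab, ?_⟩
              rw [(aux_edgeDist_zero G b a b).2 (Or.inr rfl)]; simp
            · refine ⟨a, h ▸ hab.symm, ?_⟩
              rw [(aux_edgeDist_zero G a a b).2 (Or.inl rfl)]; simp
        | succ r' =>
          obtain ⟨u, hu, hu'⟩ := aux_edgeDist_pred G w e r' hw'
          exact ⟨u, hu, hu'.trans (by exact_mod_cast Nat.le_succ r')⟩
      obtain ⟨u, hu, hu'⟩ := hex
      have hss : ((G.neighborFinset w).filter
            fun u => edgeDist G u e = ((r + 1 : ℕ) : ℕ∞)) ⊂ G.neighborFinset w := by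
        refine filter_ssubset.2 ⟨u, by simpa using hu, ?_⟩
        intro h
        rw [h] at hu'
        have : r + 1 ≤ r := by exact_mod_cast hu'
        omega
      have := card_lt_card hss
      rw [SimpleGraph.card_neighborFinset_eq_degree, hreg] at this
      omega
    calc _ ≤ _ := card_le_card hsub
      _ ≤ (univ.filter fun v => edgeDist G v e = (r : ℕ∞)).card * (d - 1) :=
          card_biUnion_le_card_mul _ _ _ hcard
      _ ≤ (2 * (d - 1) ^ r) * (d - 1) := Nat.mul_le_mul_right _ ih
      _ = _ := by ring

theorem aux_ball {n d : ℕ} (hd : 3 ≤ d) (G : SimpleGraph (Fin n)) [DecidableRel G.Adj]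
    (hreg : ∀ v, G.degree v = d) (e : Sym2 (Fin n)) (he : e ∈ G.edgeFinset) (r : ℕ) :
    (univ.filter fun v => edgeDist G v e ≤ (r : ℕ∞)).card ≤ 4 * (d - 1) ^ r := by
  induction r with
  | zero =>
    have := aux_sphere hd G hreg e he 0
    simp at this ⊢
    omega
  | succ r ih =>
    have hs := aux_sphere hd G hreg e he (r + 1)
    have hsub : (univ.filter fun v => edgeDist G v e ≤ ((r + 1 : ℕ) : ℕ∞)) ⊆
        (univ.filter fun v => edgeDist G v e ≤ (r : ℕ∞)) ∪
        (univ.filter fun v => edgeDist G v e = ((r + 1 : ℕ) : ℕ∞)) := by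
      intro v hv
      have hv' : edgeDist G v e ≤ ((r + 1 : ℕ) : ℕ∞) := by simpa using hv
      obtain ⟨x, hx⟩ := ENat.ne_top_iff_exists.1 (ne_top_of_le_ne_top (by simp) hv')
      rw [mem_union, mem_filter, mem_filter]
      rw [← hx] at hv' ⊢
      have h1 : x ≤ r + 1 := by exact_mod_cast hv'
      rcases Nat.lt_or_ge r x with h | h
      · right
        have : x = r + 1 := by omega
        exact ⟨mem_univ _, by rw [this]⟩
      · left
        exact ⟨mem_univ _, by exact_mod_cast h⟩
    have h1 := (card_le_card hsub).trans (card_union_le _ _)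
    have h2 : 2 * (d - 1) ^ r ≤ (d - 1) ^ (r + 1) := by
      rw [pow_succ, mul_comm]; exact Nat.mul_le_mul_left _ (by omega)
    omega

theorem aux_cross {n : ℕ} (G : SimpleGraph (Fin n)) (P : Finset (Fin n))
    (J : Finset (Sym2 (Fin n))) (hJ : ∀ a b, G.Adj a b → a ∈ P → b ∉ P → s(a, b) ∈ J)
    {s u : Fin n} (p : G.Walk s u) : ∀ m : ℕ, p.length ≤ m → s ∈ P → u ∉ P →
    ∃ i < m, ∃ e ∈ J, edgeDist G s e ≤ (i : ℕ∞) ∧ edgeDist G u e ≤ ((m - 1 - i : ℕ) : ℕ∞) := by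
  induction p with
  | nil => intro m _ hs hu; exact absurd hs hu
  | @cons s w u h p ih =>
    intro m hm hs hu
    rw [SimpleGraph.Walk.length_cons] at hm
    by_cases hw : w ∈ P
    · obtain ⟨i, hi, e, he, h1, h2⟩ := ih (m - 1) (by omega) hw hu
      refine ⟨i + 1, by omega, e, he, ?_, ?_⟩
      · refine (aux_edgeDist_adj G s w h e).trans ?_
        push_cast
        gcongr
      · rwa [show m - 1 - (i + 1) = m - 1 - 1 - i by omega]
    · refine ⟨0, by omega, s(s, w), hJ s w h hs hw, ?_, ?_⟩
      · rw [(aux_edgeDist_zero G s s w).2 (Or.inl rfl)]; simp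
      · rw [aux_edgeDist_mk]
        refine (min_le_right _ _).trans ?_
        rw [SimpleGraph.edist_comm]
        exact (aux_edist_le_iff G _ _ _).2 ⟨p, by omega⟩

theorem aux_expand_step {n d : ℕ} (hd : 3 ≤ d) (G : SimpleGraph (Fin n)) [DecidableRel G.Adj]
    (hreg : ∀ v, G.degree v = d) (α ρ : ℝ) (hα : 0 < α) (hρ : 0 < ρ) (hρ1 : ρ < 1)
    (hA : ExpanA n d G α) (P : Finset (Fin n)) (hP : (P.card : ℝ) ≤ n / 2)
    (J : Finset (Sym2 (Fin n))) (hJE : J ⊆ G.edgeFinset)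
    (hJ : ∀ a b, G.Adj a b → a ∈ P → b ∉ P → s(a, b) ∈ J)
    (S : Finset (Fin n)) (hS : S.Nonempty) (hSP : S ⊆ P) (m : ℕ)
    (hcnt : ∀ i < m + 1, ∀ v ∈ S,
      ((J.filter fun e => edgeDist G v e ≤ (i : ℕ∞)).card : ℝ) ≤
        α / 12 * (1 - ρ) * (ρ * ((d : ℝ) - 1)) ^ i)
    (hm : α * ((d : ℝ) - 1) ^ m * S.card < 3 * n / 4) :
    α * ((d : ℝ) - 1) ^ (m + 1) * S.card < 3 * n / 4 := by
  by_contra hcon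
  push Not at hcon
  have hn : (0 : ℝ) < n := by
    obtain ⟨v, _⟩ := hS
    exact_mod_cast v.pos
  have hD : (2 : ℝ) ≤ (d : ℝ) - 1 := by
    have : (3 : ℝ) ≤ d := by exact_mod_cast hd
    linarith
  set D : ℝ := (d : ℝ) - 1 with hDdef
  have hU := hA S hS (m + 1) (by omega)
  rw [min_eq_left hcon] at hU
  set U := univ.filter fun v => vertexSetDist G v S ≤ ((m + 1 : ℕ) : ℕ∞) with hUdef
  have hsub : U ⊆ P ∪ (range (m + 1)).biUnion fun i => S.biUnion fun s =>
      (J.filter fun e => edgeDist G s e ≤ (i : ℕ∞)).biUnion fun e =>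
        univ.filter fun v => edgeDist G v e ≤ ((m - i : ℕ) : ℕ∞) := by
    intro u hu
    by_cases huP : u ∈ P
    · exact mem_union_left _ huP
    · apply mem_union_right
      have hu' : vertexSetDist G u S ≤ ((m + 1 : ℕ) : ℕ∞) := by simpa [hUdef] using hu
      unfold vertexSetDist at hu'
      obtain ⟨s, hs, hs'⟩ := exists_mem_eq_inf S hS (fun w => G.edist u w)
      rw [hs', SimpleGraph.edist_comm, aux_edist_le_iff] at hu'
      obtain ⟨p, hp⟩ := hu'
      obtain ⟨i, hi, e, he, h1, h2⟩ := aux_cross G P J hJ p (m + 1) hp (hSP hs) huP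
      simp only [mem_biUnion, mem_filter, mem_range]
      exact ⟨i, hi, s, hs, e, ⟨he, h1⟩, mem_univ _, by simpa using h2⟩
  have hc1 : (U.card : ℝ) ≤ P.card + ∑ i ∈ range (m + 1), ∑ s ∈ S,
      ((J.filter fun e => edgeDist G s e ≤ (i : ℕ∞)).card : ℝ) * (4 * D ^ (m - i)) := by
    have h1 : U.card ≤ P.card + ∑ i ∈ range (m + 1), ∑ s ∈ S,
      ((J.filter fun e => edgeDist G s e ≤ (i : ℕ∞)).card) * (4 * (d - 1) ^ (m - i)) := by
      refine (card_le_card hsub).trans ((card_union_le _ _).trans ?_)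
      refine Nat.add_le_add_left ?_ _
      refine card_biUnion_le.trans (sum_le_sum fun i _ => ?_)
      refine card_biUnion_le.trans (sum_le_sum fun s _ => ?_)
      refine card_biUnion_le_card_mul _ _ _ fun e he => ?_
      exact aux_ball hd G hreg e (hJE (mem_filter.1 he).1) _
    have h2 : ((d - 1 : ℕ) : ℝ) = D := by
      rw [Nat.cast_sub (by omega)]; simp [hDdef]
    have h3 : (U.card : ℝ) ≤ ((P.card + ∑ i ∈ range (m + 1), ∑ s ∈ S,
      ((J.filter fun e => edgeDist G s e ≤ (i : ℕ∞)).card) * (4 * (d - 1) ^ (m - i)) : ℕ) : ℝ) :=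
      Nat.cast_le.2 h1
    refine h3.trans (le_of_eq ?_)
    push_cast [h2]
    rfl
  have hc2 : ∑ i ∈ range (m + 1), ∑ s ∈ S,
      ((J.filter fun e => edgeDist G s e ≤ (i : ℕ∞)).card : ℝ) * (4 * D ^ (m - i)) ≤
      α / 3 * D ^ m * S.card := by
    have h1 : ∀ i ∈ range (m + 1), ∑ s ∈ S,
      ((J.filter fun e => edgeDist G s e ≤ (i : ℕ∞)).card : ℝ) * (4 * D ^ (m - i)) ≤
        (α / 3 * D ^ m * S.card) * ((1 - ρ) * ρ ^ i) := by
      intro i hi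
      have hi' : i < m + 1 := mem_range.1 hi
      calc _ ≤ ∑ s ∈ S, (α / 12 * (1 - ρ) * (ρ * D) ^ i) * (4 * D ^ (m - i)) := by
            refine sum_le_sum fun s hs => ?_
            exact mul_le_mul_of_nonneg_right (hcnt i hi' s hs) (by positivity)
        _ = _ := by
            rw [sum_const, nsmul_eq_mul]
            have : D ^ m = D ^ i * D ^ (m - i) := by
              rw [← pow_add]; congr 1; omega
            rw [this, mul_pow]; ring
    refine (sum_le_sum h1).trans ?_
    rw [← mul_sum, ← mul_sum]
    have h2 : (1 - ρ) * ∑ i ∈ range (m + 1), ρ ^ i ≤ 1 := by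
      have := mul_neg_geom_sum ρ (m + 1)
      rw [this]
      have : 0 < ρ ^ (m + 1) := by positivity
      linarith
    have h3 : 0 ≤ α / 3 * D ^ m * S.card := by positivity
    nlinarith
  nlinarith

theorem aux_expand {n d : ℕ} (hd : 3 ≤ d) (G : SimpleGraph (Fin n)) [DecidableRel G.Adj]
    (hreg : ∀ v, G.degree v = d) (α ρ : ℝ) (hα : 0 < α) (hα1 : α ≤ 1) (hρ : 0 < ρ) (hρ1 : ρ < 1)
    (hA : ExpanA n d G α) (P : Finset (Fin n)) (hP : (P.card : ℝ) ≤ n / 2)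
    (J : Finset (Sym2 (Fin n))) (hJE : J ⊆ G.edgeFinset)
    (hJ : ∀ a b, G.Adj a b → a ∈ P → b ∉ P → s(a, b) ∈ J)
    (S : Finset (Fin n)) (hS : S.Nonempty) (hSP : S ⊆ P) (m : ℕ)
    (hcnt : ∀ i < m, ∀ v ∈ S,
      ((J.filter fun e => edgeDist G v e ≤ (i : ℕ∞)).card : ℝ) ≤
        α / 12 * (1 - ρ) * (ρ * ((d : ℝ) - 1)) ^ i) :
    α * ((d : ℝ) - 1) ^ m * S.card < 3 * n / 4 := by
  induction m with
  | zero =>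
    have hn : (0 : ℝ) < n := by
      obtain ⟨v, _⟩ := hS
      exact_mod_cast v.pos
    have h1 : (S.card : ℝ) ≤ P.card := by exact_mod_cast card_le_card hSP
    have h2 : (0 : ℝ) ≤ S.card := by positivity
    simp
    nlinarith
  | succ m ih =>
    exact aux_expand_step hd G hreg α ρ hα hρ hρ1 hA P hP J hJE hJ S hS hSP m hcnt
      (ih fun i hi v hv => hcnt i (by omega) v hv)

theorem aux_peel {V E : Type*} (EE : Finset E) (near : V → E → Prop)
    (θ : ℝ) (hθ : 0 ≤ θ) (N : ℕ) : ∀ (V0 : Finset V), V0.card = N →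
    (∀ S ⊆ V0, S.Nonempty → ∃ v ∈ S,
      (((EE.filter fun e => θ ≤ ((S.filter fun u => near u e).card : ℝ)).filter
        fun e => near v e).card : ℝ) ≤ θ) →
    ∃ Et : V → Finset E, (∀ v ∈ V0, ((EE.filter fun e => near v e ∧ e ∉ Et v).card : ℝ) ≤ θ) ∧
      (∀ v ∈ V0, ∀ e ∈ Et v, near v e) ∧
      ∀ e, ((V0.filter fun v => e ∈ Et v).card : ℝ) ≤ θ := by
  induction N with
  | zero =>
    intro V0 h0 _
    rw [card_eq_zero] at h0
    subst h0
    exact ⟨fun _ => ∅, by simp, by simp, fun _ => by simpa using hθ⟩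
  | succ N ih =>
    intro V0 hV h
    have hne : V0.Nonempty := by
      rw [← card_pos]; omega
    obtain ⟨v, hv, hvc⟩ := h V0 (Subset.refl _) hne
    obtain ⟨Et, h1, h2, h3⟩ := ih (V0.erase v) (by rw [card_erase_of_mem hv]; omega)
      (fun S hS => h S (hS.trans (erase_subset _ _)))
    refine ⟨Function.update Et v (EE.filter fun e => near v e ∧
      ¬ θ ≤ ((V0.filter fun u => near u e).card : ℝ)), ?_, ?_, ?_⟩
    · intro u hu
      by_cases huv : u = v
      · subst huv
        rw [Function.update_self]
        refine le_trans ?_ hvc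
        have : (EE.filter fun e => near u e ∧ e ∉ EE.filter fun e => near u e ∧
            ¬ θ ≤ ((V0.filter fun u => near u e).card : ℝ)) ⊆
          ((EE.filter fun e => θ ≤ ((V0.filter fun u => near u e).card : ℝ)).filter
            fun e => near u e) := by
          intro e he
          simp only [mem_filter] at he ⊢
          tauto
        exact_mod_cast card_le_card this
      · rw [Function.update_of_ne huv]
        exact h1 u (mem_erase.2 ⟨huv, hu⟩)
    · intro u hu e he
      by_cases huv : u = v
      · subst huv
        rw [Function.update_self, mem_filter] at he
        exact he.2.1
      · rw [Function.update_of_ne huv] at he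
        exact h2 u (mem_erase.2 ⟨huv, hu⟩) e he
    · intro e
      by_cases hev : e ∈ EE.filter fun e => near v e ∧
        ¬ θ ≤ ((V0.filter fun u => near u e).card : ℝ)
      · have hlt := (mem_filter.1 hev).2.2
        push Not at hlt
        refine le_trans ?_ hlt.le
        have : (V0.filter fun u => e ∈ Function.update Et v (EE.filter fun e => near v e ∧
            ¬ θ ≤ ((V0.filter fun u => near u e).card : ℝ)) u) ⊆
            V0.filter fun u => near u e := by
          intro u hu
          rw [mem_filter] at hu ⊢
          refine ⟨hu.1, ?_⟩
          by_cases huv : u = v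
          · rw [huv]; exact (mem_filter.1 hev).2.1
          · have := hu.2
            rw [Function.update_of_ne huv] at this
            exact h2 u (mem_erase.2 ⟨huv, hu.1⟩) e this
        exact_mod_cast card_le_card this
      · refine le_trans ?_ (h3 e)
        have : (V0.filter fun u => e ∈ Function.update Et v (EE.filter fun e => near v e ∧
            ¬ θ ≤ ((V0.filter fun u => near u e).card : ℝ)) u) ⊆
            (V0.erase v).filter fun u => e ∈ Et u := by
          intro u hu
          rw [mem_filter] at hu ⊢
          by_cases huv : u = v
          · subst huv
            have := hu.2
            rw [Function.update_self] at this
            exact absurd this hev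
          · have := hu.2
            rw [Function.update_of_ne huv] at this
            exact ⟨mem_erase.2 ⟨huv, hu.1⟩, this⟩
        exact_mod_cast card_le_card this

theorem aux_N_nonneg {k : ℕ} {N : (Fin k → ℝ) → ℝ} (hN : IsNorm k N) (x : Fin k → ℝ) :
    0 ≤ N x := by
  have h1 := hN.2.2 x (-x)
  have h2 : N (-x) = N x := by
    have := hN.2.1 (-1) x
    simpa using this
  have h3 : N (x + -x) = 0 := (hN.1 _).2 (by simp)
  linarith

theorem aux_N_sum {k : ℕ} {N : (Fin k → ℝ) → ℝ} (hN : IsNorm k N) {ι : Type*} (s : Finset ι)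
    (g : ι → Fin k → ℝ) : N (∑ i ∈ s, g i) ≤ ∑ i ∈ s, N (g i) := by
  induction s using Finset.induction_on with
  | empty => simp [(hN.1 0).2 rfl]
  | insert a s ha ih =>
    rw [sum_insert ha, sum_insert ha]
    exact (hN.2.2 _ _).trans (by linarith)

theorem aux_mono {k : ℕ} {N : (Fin k → ℝ) → ℝ} (hN : IsNorm k N) (hunc : OneUnconditional k N)
    (x y : Fin k → ℝ) (h : ∀ j, |x j| ≤ |y j|) : N x ≤ N y := by
  have key : ∀ s : Finset (Fin k), N (fun j => if j ∈ s then x j else y j) ≤ N y := by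
    intro s
    induction s using Finset.induction_on with
    | empty => simp
    | insert a s ha ih =>
      refine le_trans ?_ ih
      set z : Fin k → ℝ := fun j => if j ∈ s then x j else y j with hz
      set w : Fin k → ℝ := fun j => if j = a then - z j else z j with hw
      have hwz : N w = N z := by
        rw [hunc w, hunc z]
        congr 1
        funext j
        by_cases hj : j = a
        · simp [hw, hj]
        · simp [hw, hj]
      obtain ⟨t, ht1, ht2, ht⟩ : ∃ t : ℝ, -1 ≤ t ∧ t ≤ 1 ∧ x a = t * y a := by
        by_cases hy : y a = 0
        · refine ⟨0, by norm_num, by norm_num, ?_⟩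
          have := h a
          rw [hy] at this
          simpa using this
        · have h1 : |x a / y a| ≤ 1 := by
            rw [abs_div]
            exact div_le_one_of_le₀ (h a) (abs_nonneg _)
          refine ⟨x a / y a, (abs_le.1 h1).1, (abs_le.1 h1).2, ?_⟩
          field_simp
      have heq : (fun j => if j ∈ insert a s then x j else y j) =
          ((1 + t) / 2) • z + ((1 - t) / 2) • w := by
        funext j
        by_cases hj : j = a
        · subst hj
          simp [hz, hw, ha, ht]
          ring
        · simp [hz, hw, hj]
          split_ifs <;> ring
      rw [heq]
      refine (hN.2.2 _ _).trans ?_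
      rw [hN.2.1, hN.2.1, hwz, abs_of_nonneg (by linarith), abs_of_nonneg (by linarith)]
      apply le_of_eq; ring
  simpa using key univ

theorem aux_chi_mono {k : ℕ} {N : (Fin k → ℝ) → ℝ} (hN : IsNorm k N)
    (hunc : OneUnconditional k N) (A B : Finset (Fin k)) (h : A ⊆ B) : N (chi A) ≤ N (chi B) := by
  refine aux_mono hN hunc _ _ fun j => ?_
  unfold chi
  by_cases hj : j ∈ A
  · simp [hj, h hj]
  · simp [hj]

theorem aux_cotype {n k : ℕ} {N : (Fin k → ℝ) → ℝ} {q C : ℝ} (hq : 2 ≤ q) (hC : 1 ≤ C)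
    (hN : IsNorm k N) (hunc : OneUnconditional k N) (f : Fin n → Fin k → ℝ)
    (hval : ∀ v j, f v j = -1 ∨ f v j = 0 ∨ f v j = 1)
    (hrc : RestrictedCotype k N q C
      {y | ∃ (v : Fin n) (J : Finset (Fin k)), y = proj J fun j => |f v j|})
    (I : Finset (Fin n)) (J : Fin n → Finset (Fin k)) (hJ : ∀ i ∈ I, ∀ j ∈ J i, f i j ≠ 0)
    (hdisj : ∀ i ∈ I, ∀ i' ∈ I, ∀ j ∈ J i, j ∈ J i' → i = i')
    (D : Finset (Fin k)) (hD : ∀ i ∈ I, J i ⊆ D) :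
    ∑ i ∈ I, N (chi (J i)) ^ q ≤ (C * N (chi D)) ^ q := by
  have hz : N (chi (∅ : Finset (Fin k))) = 0 := (hN.1 _).2 (by funext j; simp [chi])
  set I' := I.filter fun i => (J i).Nonempty with hI'
  have hsum : ∑ i ∈ I, N (chi (J i)) ^ q = ∑ i ∈ I', N (chi (J i)) ^ q := by
    symm
    refine sum_subset (filter_subset _ _) fun i hi hi' => ?_
    have : J i = ∅ := by
      by_contra hne
      exact hi' (mem_filter.2 ⟨hi, nonempty_iff_ne_empty.2 hne⟩)
    rw [this, hz, Real.zero_rpow (by linarith)]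
  rw [hsum]
  have hnn : 0 ≤ C * N (chi D) := mul_nonneg (by linarith) (aux_N_nonneg hN _)
  rcases Nat.eq_zero_or_pos I'.card with h0 | hpos
  · rw [card_eq_zero] at h0
    rw [h0, sum_empty]
    exact Real.rpow_nonneg hnn _
  set eqv := I'.equivFin.symm with heqv
  have hmem : ∀ i, (eqv i : Fin n) ∈ I ∧ (J (eqv i)).Nonempty := fun i =>
    mem_filter.1 (eqv i).2
  have hinj : Function.Injective fun i => chi (J (eqv i)) := by
    intro i i' h
    obtain ⟨j, hj⟩ := (hmem i).2
    have h1 := congrFun h j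
    have hj' : j ∈ J (eqv i') := by
      by_contra hn
      simp [chi, hj, hn] at h1
    have := hdisj _ (hmem i).1 _ (hmem i').1 j hj hj'
    exact eqv.injective (Subtype.ext this)
  have hmain := hrc I'.card hpos (fun i => chi (J (eqv i))) hinj (by
    intro i
    refine ⟨eqv i, J (eqv i), ?_⟩
    funext j
    unfold chi proj
    by_cases hj : j ∈ J (eqv i)
    · simp only [hj, if_true]
      rcases hval (eqv i) j with h | h | h
      · rw [h]; norm_num
      · exact absurd h (hJ _ (hmem i).1 j hj)
      · rw [h]; norm_num
    · simp [hj])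
  have hσ : ∀ σ : Fin I'.card → Bool,
      N (∑ i, (if σ i then (1 : ℝ) else -1) • chi (J (eqv i))) ^ q ≤ N (chi D) ^ q := by
    intro σ
    refine Real.rpow_le_rpow (aux_N_nonneg hN _) (aux_mono hN hunc _ _ fun j => ?_) (by linarith)
    rw [Finset.sum_apply]
    by_cases hex : ∃ i, j ∈ J (eqv i)
    · obtain ⟨i, hi⟩ := hex
      rw [sum_eq_single i]
      · have : j ∈ D := hD _ (hmem i).1 hi
        simp only [Pi.smul_apply, chi, hi, this, if_true]
        split_ifs <;> simp
      · intro b _ hb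
        have : j ∉ J (eqv b) := fun hbj =>
          hb (eqv.injective (Subtype.ext (hdisj _ (hmem b).1 _ (hmem i).1 j hbj hi)))
        simp [chi, this]
      · simp
    · push Not at hex
      rw [sum_eq_zero]
      · simp
      · intro i _
        simp [chi, hex i]
  have h2 : 1 / (2 : ℝ) ^ I'.card * ∑ σ : Fin I'.card → Bool,
      N (∑ i, (if σ i then (1 : ℝ) else -1) • chi (J (eqv i))) ^ q ≤ N (chi D) ^ q := by
    calc _ ≤ 1 / (2 : ℝ) ^ I'.card * ∑ σ : Fin I'.card → Bool, N (chi D) ^ q := by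
          exact mul_le_mul_of_nonneg_left (sum_le_sum fun σ _ => hσ σ) (by positivity)
      _ = N (chi D) ^ q := by
          simp
  have h3 := hmain.trans h2
  have hCq : 0 < C ^ q := Real.rpow_pos_of_pos (by linarith) _
  rw [Real.mul_rpow (by linarith) (aux_N_nonneg hN _)]
  have h4 : ∑ i, N (chi (J (eqv i))) ^ q = ∑ i ∈ I', N (chi (J i)) ^ q := by
    rw [← Finset.sum_coe_sort I' (fun i => N (chi (J i)) ^ q)]
    exact Equiv.sum_comp eqv (fun i : I' => N (chi (J i)) ^ q)
  rw [h4] at h3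
  rw [one_div, inv_mul_le_iff₀ hCq] at h3
  exact h3

theorem aux_collide {n t : ℕ} (v v' : Fin n) (hne : v ≠ v') :
    t * (univ.filter fun c : Fin n → Fin t => c v' = c v).card =
      (univ : Finset (Fin n → Fin t)).card := by
  have h1 : (univ.filter fun p : (Fin n → Fin t) × Fin t => p.1 v' = p.1 v).card =
      (univ.filter fun c : Fin n → Fin t => c v' = c v).card * t := by
    have : (univ.filter fun p : (Fin n → Fin t) × Fin t => p.1 v' = p.1 v) =
        (univ.filter fun c : Fin n → Fin t => c v' = c v) ×ˢ (univ : Finset (Fin t)) := by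
      ext p; simp
    rw [this, card_product]; simp
  have h2 : (univ.filter fun p : (Fin n → Fin t) × Fin t => p.2 = p.1 v).card =
      (univ : Finset (Fin n → Fin t)).card := by
    symm
    refine card_bij (fun c _ => (c, c v)) (by simp) ?_ ?_
    · intro a _ b _ h
      exact (Prod.ext_iff.1 h).1
    · rintro ⟨c, a⟩ h
      simp at h
      exact ⟨c, mem_univ _, by rw [h]⟩
  rw [mul_comm, ← h1, ← h2]
  refine card_bij' (fun p _ => (Function.update p.1 v' p.2, p.1 v'))
    (fun p _ => (Function.update p.1 v' p.2, p.1 v')) ?_ ?_ ?_ ?_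
  · intro p hp
    simp at hp
    simp [hne, hp]
  · intro p hp
    simp at hp
    simp [hne, hp]
  · intro p _
    simp
  · intro p _
    simp

theorem aux_young (x B q τ : ℝ) (hx : 0 ≤ x) (hq : 2 ≤ q) (hB : 0 < B) (hτ : 0 < τ) :
    x ≤ B * τ + x ^ q / B ^ q * (B * τ ^ (1 - q)) := by
  have h0 : 0 ≤ x ^ q / B ^ q * (B * τ ^ (1 - q)) := by positivity
  by_cases h : x ≤ B * τ
  · linarith
  · push Not at h
    have h1 : 0 < B * τ := by positivity
    have hx' : 0 < x := by linarith
    have h2 : (B * τ) ^ (q - 1) ≤ x ^ (q - 1) :=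
      Real.rpow_le_rpow h1.le h.le (by linarith)
    have h3 : x ^ q / B ^ q * (B * τ ^ (1 - q)) = x * (x ^ (q - 1) / (B * τ) ^ (q - 1)) := by
      rw [Real.mul_rpow hB.le hτ.le, Real.rpow_sub_one hx'.ne', Real.rpow_sub_one hB.ne',
        show (1 - q) = -(q - 1) by ring, Real.rpow_neg hτ.le]
      have : 0 < τ ^ (q - 1) := by positivity
      field_simp
    have h4 : 1 ≤ x ^ (q - 1) / (B * τ) ^ (q - 1) := by
      rw [le_div_iff₀ (by positivity)]; linarith
    rw [h3]
    nlinarith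

/-- key: bound for families with bounded overlap -/
theorem aux_color {n k : ℕ} {N : (Fin k → ℝ) → ℝ} {q C : ℝ} (hq : 2 ≤ q) (hC : 1 ≤ C)
    (hN : IsNorm k N) (hunc : OneUnconditional k N) (f : Fin n → Fin k → ℝ)
    (hval : ∀ v j, f v j = -1 ∨ f v j = 0 ∨ f v j = 1)
    (hrc : RestrictedCotype k N q C
      {y | ∃ (v : Fin n) (J : Finset (Fin k)), y = proj J fun j => |f v j|})
    (I : Finset (Fin n)) (J : Fin n → Finset (Fin k)) (hJ : ∀ i ∈ I, ∀ j ∈ J i, f i j ≠ 0)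
    (D : Finset (Fin k)) (hD : ∀ i ∈ I, J i ⊆ D) (t : ℕ) (ht : 0 < t)
    (hov : ∀ j, 2 * (I.filter fun i => j ∈ J i).card ≤ t) (τ : ℝ) (hτ : 0 < τ) :
    ∑ i ∈ I, N (chi (J i)) ≤
      2 * ((C * N (chi D)) * (I.card * τ + t * τ ^ (1 - q))) := by
  set B := C * N (chi D) with hBdef
  have hB : 0 ≤ B := mul_nonneg (by linarith) (aux_N_nonneg hN _)
  rcases hB.eq_or_lt with hB0 | hBpos
  · rw [← hB0, zero_mul, mul_zero]
    refine sum_nonpos fun i hi => ?_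
    have h1 := aux_chi_mono hN hunc _ _ (hD i hi)
    have h2 := aux_N_nonneg hN (chi D)
    nlinarith
  -- disjointified sets
  let J' : (Fin n → Fin t) → Fin n → Finset (Fin k) := fun c i =>
    (J i).filter fun j => ∀ i' ∈ I, i' ≠ i → j ∈ J i' → c i' ≠ c i
  have hc : ∀ c : Fin n → Fin t, ∑ i ∈ I, N (chi (J' c i)) ≤
      B * (I.card * τ + t * τ ^ (1 - q)) := by
    intro c
    have h1 : ∑ i ∈ I, N (chi (J' c i)) ^ q ≤ t * B ^ q := by
      rw [← sum_fiberwise I c]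
      calc _ ≤ ∑ a : Fin t, B ^ q := by
            refine sum_le_sum fun a _ => ?_
            refine aux_cotype hq hC hN hunc f hval hrc _ (J' c) ?_ ?_ D ?_
            · intro i hi j hj
              exact hJ i (mem_filter.1 hi).1 j (mem_filter.1 hj).1
            · intro i hi i' hi' j hj hj'
              by_contra hne
              rw [mem_filter] at hi hi' hj hj'
              exact hj.2 i' hi'.1 (Ne.symm hne) hj'.1 (hi'.2.trans hi.2.symm)
            · intro i hi
              exact (filter_subset _ _).trans (hD i (mem_filter.1 hi).1)
        _ = t * B ^ q := by simp
    calc _ ≤ ∑ i ∈ I, (B * τ + N (chi (J' c i)) ^ q / B ^ q * (B * τ ^ (1 - q))) :=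
          sum_le_sum fun i _ => aux_young _ B q τ (aux_N_nonneg hN _) hq hBpos hτ
      _ = I.card * (B * τ) + (∑ i ∈ I, N (chi (J' c i)) ^ q) / B ^ q * (B * τ ^ (1 - q)) := by
          rw [sum_add_distrib, sum_const, nsmul_eq_mul, ← sum_mul, ← sum_div]
      _ ≤ I.card * (B * τ) + (t * B ^ q) / B ^ q * (B * τ ^ (1 - q)) := by
          gcongr
      _ = _ := by
          have : 0 < B ^ q := by positivity
          field_simp
  -- averaging
  set T : ℕ := (univ : Finset (Fin n → Fin t)).card with hT
  have hTpos : 0 < T := by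
    rw [hT, card_univ, Fintype.card_fun, Fintype.card_fin]
    positivity
  have hcount : ∀ i ∈ I, ∀ j ∈ J i,
      T ≤ 2 * (univ.filter fun c : Fin n → Fin t => j ∈ J' c i).card := by
    intro i hi j hj
    have hsub : (univ.filter fun c : Fin n → Fin t => ¬ j ∈ J' c i) ⊆
        (I.filter fun i' => j ∈ J i' ∧ i' ≠ i).biUnion
          fun i' => univ.filter fun c : Fin n → Fin t => c i' = c i := by
      intro c hcc
      rw [mem_filter] at hcc
      have := hcc.2
      simp only [J', mem_filter, hj, true_and] at this
      push Not at this
      obtain ⟨i', h1, h2, h3, h4⟩ := this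
      rw [mem_biUnion]
      exact ⟨i', mem_filter.2 ⟨h1, h3, h2⟩, mem_filter.2 ⟨mem_univ _, h4⟩⟩
    have h1 := (card_le_card hsub).trans card_biUnion_le
    have h2 : t * (univ.filter fun c : Fin n → Fin t => ¬ j ∈ J' c i).card ≤
        (I.filter fun i' => j ∈ J i').card * T := by
      calc _ ≤ t * ∑ i' ∈ I.filter fun i' => j ∈ J i' ∧ i' ≠ i,
              (univ.filter fun c : Fin n → Fin t => c i' = c i).card :=
            Nat.mul_le_mul_left _ h1
        _ = ∑ i' ∈ I.filter fun i' => j ∈ J i' ∧ i' ≠ i, T := by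
            rw [mul_sum]
            refine sum_congr rfl fun i' hi' => ?_
            exact aux_collide i i' (Ne.symm (mem_filter.1 hi').2.2)
        _ = (I.filter fun i' => j ∈ J i' ∧ i' ≠ i).card * T := by simp
        _ ≤ _ := by
            refine Nat.mul_le_mul_right _ (card_le_card ?_)
            intro x hx
            rw [mem_filter] at hx ⊢
            exact ⟨hx.1, hx.2.1⟩
    have h3 : 2 * (univ.filter fun c : Fin n → Fin t => ¬ j ∈ J' c i).card ≤ T := by
      have h4 : t * (2 * (univ.filter fun c : Fin n → Fin t => ¬ j ∈ J' c i).card) ≤ t * T := by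
        calc _ = 2 * (t * (univ.filter fun c : Fin n → Fin t => ¬ j ∈ J' c i).card) := by ring
          _ ≤ 2 * ((I.filter fun i' => j ∈ J i').card * T) := Nat.mul_le_mul_left _ h2
          _ = (2 * (I.filter fun i' => j ∈ J i').card) * T := by ring
          _ ≤ t * T := Nat.mul_le_mul_right _ (hov j)
      exact Nat.le_of_mul_le_mul_left h4 ht
    have h5 := card_filter_add_card_filter_not (s := (univ : Finset (Fin n → Fin t)))
      (fun c => j ∈ J' c i)
    rw [← hT] at h5
    omega
  have havg : ∀ i ∈ I, T * N (chi (J i)) ≤ 2 * ∑ c, N (chi (J' c i)) := by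
    intro i hi
    have h1 : N ((T : ℝ) • chi (J i)) ≤ N ((2 : ℝ) • ∑ c, chi (J' c i)) := by
      refine aux_mono hN hunc _ _ fun j => ?_
      have h0 : (∑ c, chi (J' c i)) j =
          ((univ.filter fun c : Fin n → Fin t => j ∈ J' c i).card : ℝ) := by
        rw [Finset.sum_apply]
        simp [chi]
      rw [Pi.smul_apply, Pi.smul_apply, h0]
      by_cases hj : j ∈ J i
      · have := hcount i hi j hj
        have h' : (T : ℝ) ≤ 2 * ((univ.filter fun c : Fin n → Fin t => j ∈ J' c i).card : ℝ) := by
          exact_mod_cast this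
        simp only [chi, hj, if_true, smul_eq_mul, mul_one]
        rw [abs_of_nonneg (by positivity), abs_of_nonneg (by positivity)]
        exact h'
      · simp [chi, hj]
    rw [hN.2.1, hN.2.1, abs_of_nonneg (by positivity), abs_of_nonneg (by positivity)] at h1
    refine h1.trans ?_
    gcongr
    exact aux_N_sum hN _ _
  have hfin : T * ∑ i ∈ I, N (chi (J i)) ≤
      T * (2 * (B * (I.card * τ + t * τ ^ (1 - q)))) := by
    calc _ = ∑ i ∈ I, T * N (chi (J i)) := by rw [mul_sum]
      _ ≤ ∑ i ∈ I, 2 * ∑ c, N (chi (J' c i)) := sum_le_sum havg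
      _ = 2 * ∑ c, ∑ i ∈ I, N (chi (J' c i)) := by rw [← mul_sum, sum_comm]
      _ ≤ 2 * ∑ c : Fin n → Fin t, B * (I.card * τ + t * τ ^ (1 - q)) := by
          gcongr with c _
          exact hc c
      _ = _ := by
          rw [sum_const, nsmul_eq_mul, ← hT]; ring
  exact le_of_mul_le_mul_left hfin (by exact_mod_cast hTpos)

/-- `e` is a jump edge for the coordinate `j`. -/
def auxJump {n k : ℕ} (f : Fin n → Fin k → ℝ) (j : Fin k) (e : Sym2 (Fin n)) : Prop :=
  Sym2.lift ⟨fun a b => f a j ≠ f b j, fun _ _ => propext ne_comm⟩ e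

theorem aux_edgeNorm {n k : ℕ} {N : (Fin k → ℝ) → ℝ} (hN : IsNorm k N)
    (hunc : OneUnconditional k N) (f : Fin n → Fin k → ℝ)
    (hval : ∀ v j, f v j = -1 ∨ f v j = 0 ∨ f v j = 1) (e : Sym2 (Fin n)) :
    N (chi (univ.filter fun j => auxJump f j e)) ≤ edgeNorm N f e := by
  induction e with
  | _ a b =>
    have key : ∀ a b : Fin n, ∀ j, |chi (univ.filter fun j => auxJump f j s(a, b)) j| ≤
        |(f a - f b) j| := by
      intro a b j
      by_cases h : f a j = f b j
      · have : ¬ auxJump f j s(a, b) := fun h' => h' h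
        simp [chi, this]
      · have h' : auxJump f j s(a, b) := h
        simp only [chi, mem_filter, mem_univ, h', true_and, if_true, Pi.sub_apply]
        rcases hval a j with h1 | h1 | h1 <;> rcases hval b j with h2 | h2 | h2 <;>
          first
          | exact absurd (h1.trans h2.symm) h
          | (rw [h1, h2]; norm_num)
    change _ ≤ min (N (f a - f b)) (N (f b - f a))
    refine le_min (aux_mono hN hunc _ _ (key a b)) ?_
    rw [Sym2.eq_swap]
    exact aux_mono hN hunc _ _ (key b a)

theorem aux_core {k : ℕ} {E : Type*} {N : (Fin k → ℝ) → ℝ} (hN : IsNorm k N)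
    (hunc : OneUnconditional k N) (F : Finset E) (A : E → Finset (Fin k)) (J : Finset (Fin k))
    (thr : ℝ) (hthr : 0 ≤ thr) (h : ∀ j ∈ J, thr ≤ ((F.filter fun e => j ∈ A e).card : ℝ)) :
    thr * N (chi J) ≤ ∑ e ∈ F, N (chi (A e)) := by
  refine le_trans ?_ (aux_N_sum hN F _)
  have h1 : thr * N (chi J) = N (thr • chi J) := by rw [hN.2.1, abs_of_nonneg hthr]
  rw [h1]
  refine aux_mono hN hunc _ _ fun j => ?_
  have h0 : (∑ e ∈ F, chi (A e)) j = ((F.filter fun e => j ∈ A e).card : ℝ) := by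
    rw [Finset.sum_apply]
    simp [chi]
  rw [Pi.smul_apply, h0]
  by_cases hj : j ∈ J
  · simp only [chi, hj, if_true, smul_eq_mul, mul_one]
    rw [abs_of_nonneg hthr, abs_of_nonneg (by positivity)]
    exact h j hj
  · simp [chi, hj]

theorem aux_swap {n : ℕ} (E : Finset (Sym2 (Fin n))) (near : Fin n → Sym2 (Fin n) → Prop)
    (g : Fin n → Sym2 (Fin n) → ℝ) :
    ∑ v, ∑ e ∈ E.filter (fun e => near v e), g v e =
      ∑ e ∈ E, ∑ v ∈ univ.filter (fun v => near v e), g v e := by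
  simp only [sum_filter]
  rw [sum_comm]

theorem aux_half {n k : ℕ} (f : Fin n → Fin k → ℝ)
    (hmed : ∀ j, (n : ℝ) / 2 ≤
      min ((univ.filter fun v => 0 ≤ f v j).card : ℝ)
        ((univ.filter fun v => f v j ≤ 0).card : ℝ)) (j : Fin k) (s : ℝ) (hs : s ≠ 0) :
    ((univ.filter fun v => f v j = s).card : ℝ) ≤ n / 2 := by
  have key : ∀ p : Fin n → Prop, (∀ v, f v j = s → ¬ p v) →
      (n : ℝ) / 2 ≤ ((univ.filter fun v => p v).card : ℝ) →
      ((univ.filter fun v => f v j = s).card : ℝ) ≤ n / 2 := by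
    intro p hp hc
    have h1 := card_filter_add_card_filter_not (s := (univ : Finset (Fin n))) p
    have h2 : (univ.filter fun v => f v j = s).card ≤ (univ.filter fun v => ¬ p v).card := by
      refine card_le_card fun v hv => ?_
      rw [mem_filter] at hv ⊢
      exact ⟨hv.1, hp v hv.2⟩
    rw [card_univ, Fintype.card_fin] at h1
    have h1' : ((univ.filter fun v => p v).card : ℝ) + ((univ.filter fun v => ¬ p v).card : ℝ) = n := by
      exact_mod_cast h1
    have h2' : ((univ.filter fun v => f v j = s).card : ℝ) ≤
      ((univ.filter fun v => ¬ p v).card : ℝ) := by exact_mod_cast h2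
    linarith
  rcases lt_or_gt_of_ne hs with h | h
  · refine key (fun v => 0 ≤ f v j) (fun v hv => ?_) ((hmed j).trans (min_le_left _ _))
    rw [hv]; push Not; exact h
  · refine key (fun v => f v j ≤ 0) (fun v hv => ?_) ((hmed j).trans (min_le_right _ _))
    rw [hv]; push Not; exact h

/-- numeric bound on `λ` -/
theorem aux_lam (q ε D ρ : ℝ) (hq : 2 ≤ q) (hε : 0 < ε) (hε1 : ε ≤ 1) (hD : 2 ≤ D)
    (hρ : ρ = 1 - ε / (2 * q * (D + 1))) (r : ℕ) :
    (D - ε) ^ (r + 1) ≤ D * D ^ r * (ρ ^ (2 * r)) ^ q := by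
  have hx : ε / (2 * q * (D + 1)) ≤ 1 := by
    rw [div_le_one (by positivity)]; nlinarith
  have hx0 : 0 < ε / (2 * q * (D + 1)) := by positivity
  have hρ0 : 0 ≤ ρ := by rw [hρ]; linarith
  have h1 : 1 - ε / (D + 1) ≤ ρ ^ (2 * q) := by
    have := one_add_mul_self_le_rpow_one_add (s := -(ε / (2 * q * (D + 1)))) (by linarith)
      (p := 2 * q) (by linarith)
    rw [hρ, sub_eq_add_neg 1 (ε / (2 * q * (D + 1)))]
    refine le_trans (le_of_eq ?_) this
    field_simp
    ring
  have h2 : D - ε ≤ D * ρ ^ (2 * q) := by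
    have h3 : D - ε ≤ D * (1 - ε / (D + 1)) := by
      have : ε / (D + 1) * (D + 1) = ε := by field_simp
      have h5 : 0 ≤ ε / (D + 1) := by positivity
      nlinarith
    have := mul_le_mul_of_nonneg_left h1 (show 0 ≤ D by linarith)
    linarith
  have h4 : (ρ ^ (2 * r)) ^ q = (ρ ^ (2 * q)) ^ r := by
    rw [← Real.rpow_natCast, ← Real.rpow_natCast, ← Real.rpow_mul hρ0, ← Real.rpow_mul hρ0]
    congr 1
    push_cast
    ring
  rw [h4, mul_assoc, ← mul_pow, pow_succ, mul_comm]
  have h5 : 0 ≤ D - ε := by linarith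
  gcongr
  linarith

theorem aux_geom (ρ : ℝ) (h0 : 0 < ρ) (h1 : ρ < 1) (R : ℕ) :
    ∑ r ∈ range R, ρ ^ r ≤ 1 / (1 - ρ) := by
  rw [le_div_iff₀ (by linarith), mul_comm, mul_neg_geom_sum]
  have : 0 < ρ ^ R := by positivity
  linarith

theorem aux_final (q C α ε L d : ℝ)
    (hq : 2 ≤ q) (hC : 1 ≤ C) (hd : 3 ≤ d)
    (hα : 0 < α) (hα1 : α ≤ 1) (hε : 0 < ε) (hε1 : ε ≤ 1) (hL : 1 ≤ L) :
    28 * L * d * C / ((α / 12) ^ 2 * (ε / (2 * q * d)) ^ 2) * (1 / (ε / (2 * q * d))) ≤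
      2 ^ 113 * q ^ 10 * C ^ 2 * (d ^ 24 * L ^ 8 / (α ^ 14 * ε ^ 18)) := by
  have e1 : 28 * L * d * C / ((α / 12) ^ 2 * (ε / (2 * q * d)) ^ 2) * (1 / (ε / (2 * q * d))) =
      32256 * q ^ 3 * C * (d ^ 4 * L / (α ^ 2 * ε ^ 3)) := by
    field_simp
    norm_num
  rw [e1]
  have h1 : q ^ 3 ≤ q ^ 10 := pow_le_pow_right₀ (by linarith) (by norm_num)
  have h2 : C ≤ C ^ 2 := by nlinarith
  have h3 : d ^ 4 ≤ d ^ 24 := pow_le_pow_right₀ (by linarith) (by norm_num)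
  have h4 : L ≤ L ^ 8 := le_self_pow₀ hL (by norm_num)
  have h5 : α ^ 14 ≤ α ^ 2 := pow_le_pow_of_le_one hα.le hα1 (by norm_num)
  have h6 : ε ^ 18 ≤ ε ^ 3 := pow_le_pow_of_le_one hε.le hε1 (by norm_num)
  have h7 : (32256 : ℝ) ≤ 2 ^ 113 := by norm_num
  gcongr

set_option maxHeartbeats 1000000 in
theorem aux_scale {n d k : ℕ} (q C α ε L : ℝ)
    (hq : 2 ≤ q) (hC : 1 ≤ C) (hd : 3 ≤ d)
    (hα : 0 < α ∧ α ≤ 1) (hε : 0 < ε ∧ ε ≤ 1) (hL : 1 ≤ L)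
    (G : SimpleGraph (Fin n)) [DecidableRel G.Adj]
    (hreg : ∀ v, G.degree v = d) (N : (Fin k → ℝ) → ℝ)
    (hN : IsNorm k N) (hunc : OneUnconditional k N)
    (f : Fin n → Fin k → ℝ)
    (hval : ∀ v j, f v j = -1 ∨ f v j = 0 ∨ f v j = 1)
    (hrc : RestrictedCotype k N q C
      {y | ∃ (v : Fin n) (J : Finset (Fin k)), y = proj J fun j => |f v j|})
    (ρ : ℝ) (hρ : ρ = 1 - ε / (2 * q * d)) (hρ0 : 0 < ρ) (hρ1 : ρ < 1) (r : ℕ)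
    (J : Fin n → Finset (Fin k)) (hJ : ∀ v, ∀ j ∈ J v, f v j ≠ 0)
    (hcnt : ∀ v, ∀ j ∈ J v, α / 12 * (1 - ρ) * (ρ * ((d : ℝ) - 1)) ^ r ≤
      (((G.edgeFinset.filter fun e => auxJump f j e).filter
        fun e => edgeDist G v e ≤ (r : ℕ∞)).card : ℝ))
    (Et : Fin k → Fin n → Finset (Sym2 (Fin n)))
    (hEt1 : ∀ v, ∀ j ∈ J v, ((G.edgeFinset.filter fun e =>
      edgeDist G v e ≤ (r : ℕ∞) ∧ e ∉ Et j v).card : ℝ) ≤ L * ((d : ℝ) - 1 - ε) ^ (r + 1))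
    (hEt2 : ∀ j e, ((univ.filter fun v => j ∈ J v ∧ e ∈ Et j v).card : ℝ) ≤
      2 * (L * ((d : ℝ) - 1 - ε) ^ (r + 1))) :
    ∑ v, N (chi (J v)) ≤ 28 * L * d * C / ((α / 12) ^ 2 * (1 - ρ) ^ 2) * ρ ^ r *
      ∑ e ∈ G.edgeFinset, edgeNorm N f e := by
  have hd' : (3 : ℝ) ≤ d := by exact_mod_cast hd
  set D : ℝ := (d : ℝ) - 1 with hDdef
  have hD : 2 ≤ D := by linarith
  have hDd : (d : ℝ) = D + 1 := by rw [hDdef]; ring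
  have hDnat : ((d - 1 : ℕ) : ℝ) = D := by
    rw [Nat.cast_sub (by omega)]; simp [hDdef]
  obtain ⟨hα0, hα1⟩ := hα
  obtain ⟨hε0, hε1⟩ := hε
  set Es := ∑ e ∈ G.edgeFinset, edgeNorm N f e with hEs
  have hen : ∀ e, 0 ≤ edgeNorm N f e := fun e =>
    (aux_N_nonneg hN _).trans (aux_edgeNorm hN hunc f hval e)
  have hEs0 : 0 ≤ Es := sum_nonneg fun e _ => hen e
  set thr := α / 12 * (1 - ρ) * (ρ * D) ^ r with hthr
  have h1ρ : 0 < 1 - ρ := by linarith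
  have hthr0 : 0 < thr := by positivity
  set τ := ρ ^ (2 * r) with hτ
  have hτ0 : 0 < τ := by positivity
  have hτ1 : τ ≤ 1 := pow_le_one₀ hρ0.le hρ1.le
  have hlam := aux_lam q ε D ρ hq hε0 hε1 hD (by rw [hρ, hDd]) r
  rw [← hτ] at hlam
  set Λ := (D - ε) ^ (r + 1) with hΛ
  have hΛ1 : 1 ≤ Λ := one_le_pow₀ (by linarith)
  have hball : ∀ e ∈ G.edgeFinset,
      ((univ.filter fun v => edgeDist G v e ≤ (r : ℕ∞)).card : ℝ) ≤ 4 * D ^ r := by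
    intro e he
    have := aux_ball hd G hreg e he r
    have h' : ((univ.filter fun v => edgeDist G v e ≤ (r : ℕ∞)).card : ℝ) ≤
      ((4 * (d - 1) ^ r : ℕ) : ℝ) := Nat.cast_le.2 this
    refine h'.trans (le_of_eq ?_)
    push_cast [hDnat]
    rfl
  set c := α / 12 * (1 - ρ) with hc
  have hc0 : 0 < c := by positivity
  have hc1 : c ≤ 1 := by
    rw [hc]
    exact mul_le_one₀ (by linarith) h1ρ.le (by linarith)
  have hcc : (α / 12) ^ 2 * (1 - ρ) ^ 2 = c ^ 2 := by rw [hc]; ring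
  rw [hcc]
  have hDr : 0 < D ^ r := by positivity
  have hρr : 0 < ρ ^ r := by positivity
  have hρr1 : ρ ^ r ≤ 1 := pow_le_one₀ hρ0.le hρ1.le
  have hτρ : τ = ρ ^ r * ρ ^ r := by rw [hτ, two_mul, pow_add]
  have hthr' : thr = c * ρ ^ r * D ^ r := by rw [hthr, mul_pow]; ring
  have hLD : 2 ≤ L * D := by
    have := mul_le_mul hL hD (by norm_num) (by linarith)
    linarith
  clear_value thr c Λ τ Es D
  rcases le_or_gt (2 * (L * Λ)) thr with hgood | hbad
  · -- good case
    have hstep : thr / 2 * ∑ v, N (chi (J v)) ≤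
        ∑ e ∈ G.edgeFinset, ∑ v ∈ univ.filter (fun v => edgeDist G v e ≤ (r : ℕ∞)),
          N (chi ((J v).filter fun j => auxJump f j e ∧ e ∈ Et j v)) := by
      rw [← aux_swap G.edgeFinset (fun v e => edgeDist G v e ≤ (r : ℕ∞)), mul_sum]
      refine sum_le_sum fun v _ => ?_
      refine aux_core hN hunc _ (fun e => (J v).filter fun j => auxJump f j e ∧ e ∈ Et j v)
        (J v) (thr / 2) (by linarith) fun j hj => ?_
      have h1 := hcnt v j hj
      have h2 := hEt1 v j hj
      have h3 : (((G.edgeFinset.filter fun e => auxJump f j e).filter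
        fun e => edgeDist G v e ≤ (r : ℕ∞)).card) ≤
          ((G.edgeFinset.filter fun e => edgeDist G v e ≤ (r : ℕ∞)).filter fun e =>
            j ∈ (J v).filter fun j => auxJump f j e ∧ e ∈ Et j v).card +
          (G.edgeFinset.filter fun e => edgeDist G v e ≤ (r : ℕ∞) ∧ e ∉ Et j v).card := by
        refine le_trans (card_le_card ?_) (card_union_le _ _)
        intro e he
        simp only [mem_union, mem_filter] at he ⊢
        tauto
      have h4 : ((((G.edgeFinset.filter fun e => auxJump f j e).filter
        fun e => edgeDist G v e ≤ (r : ℕ∞)).card : ℕ) : ℝ) ≤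
          (((G.edgeFinset.filter fun e => edgeDist G v e ≤ (r : ℕ∞)).filter fun e =>
            j ∈ (J v).filter fun j => auxJump f j e ∧ e ∈ Et j v).card : ℝ) +
          ((G.edgeFinset.filter fun e => edgeDist G v e ≤ (r : ℕ∞) ∧ e ∉ Et j v).card : ℝ) := by
        exact_mod_cast h3
      linarith
    set t : ℕ := ⌈4 * (L * Λ)⌉₊ with ht
    have hLΛ : 1 ≤ L * Λ := one_le_mul_of_one_le_of_one_le hL hΛ1
    have htpos : 0 < t := Nat.ceil_pos.2 (by linarith)
    have ht1 : (t : ℝ) ≤ 5 * (L * Λ) := by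
      have := Nat.ceil_lt_add_one (a := 4 * (L * Λ)) (by linarith)
      linarith
    have ht2 : 4 * (L * Λ) ≤ t := Nat.le_ceil _
    clear_value t
    have hedge : ∀ e ∈ G.edgeFinset,
        ∑ v ∈ univ.filter (fun v => edgeDist G v e ≤ (r : ℕ∞)),
          N (chi ((J v).filter fun j => auxJump f j e ∧ e ∈ Et j v)) ≤
        14 * (L * D) * C * D ^ r * τ * edgeNorm N f e := by
      intro e he
      have h1 := aux_color hq hC hN hunc f hval hrc
        (univ.filter (fun v => edgeDist G v e ≤ (r : ℕ∞)))
        (fun v => (J v).filter fun j => auxJump f j e ∧ e ∈ Et j v)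
        (fun v _ j hj => hJ v j (mem_filter.1 hj).1)
        (univ.filter fun j => auxJump f j e)
        (fun v _ j hj => mem_filter.2 ⟨mem_univ _, (mem_filter.1 hj).2.1⟩)
        t htpos (by
          intro j
          have h2 := hEt2 j e
          have h3 : ((univ.filter (fun v => edgeDist G v e ≤ (r : ℕ∞))).filter fun v =>
            j ∈ (J v).filter fun j => auxJump f j e ∧ e ∈ Et j v).card ≤
            (univ.filter fun v => j ∈ J v ∧ e ∈ Et j v).card := by
            refine card_le_card fun v hv => ?_
            simp only [mem_filter, mem_univ, true_and] at hv ⊢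
            tauto
          have h4 : (((univ.filter (fun v => edgeDist G v e ≤ (r : ℕ∞))).filter fun v =>
            j ∈ (J v).filter fun j => auxJump f j e ∧ e ∈ Et j v).card : ℝ) ≤
            ((univ.filter fun v => j ∈ J v ∧ e ∈ Et j v).card : ℝ) := by exact_mod_cast h3
          have h5 : (2 : ℝ) * (((univ.filter (fun v => edgeDist G v e ≤ (r : ℕ∞))).filter fun v =>
            j ∈ (J v).filter fun j => auxJump f j e ∧ e ∈ Et j v).card : ℝ) ≤ t := by linarith
          exact_mod_cast h5) τ hτ0
      refine h1.trans ?_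
      have h6 := aux_edgeNorm hN hunc f hval e
      have h9 : 0 < τ ^ (1 - q) := Real.rpow_pos_of_pos hτ0 _
      have h7 : (t : ℝ) * τ ^ (1 - q) ≤ 5 * (L * D) * D ^ r * τ := by
        have h8 : τ ^ q * τ ^ (1 - q) = τ := by
          rw [← Real.rpow_add hτ0]; simp
        calc (t : ℝ) * τ ^ (1 - q) ≤ (5 * (L * (D * D ^ r * τ ^ q))) * τ ^ (1 - q) := by
              refine mul_le_mul_of_nonneg_right (ht1.trans ?_) h9.le
              have := mul_le_mul_of_nonneg_left hlam (show 0 ≤ L by linarith)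
              linarith
          _ = 5 * (L * D) * D ^ r * (τ ^ q * τ ^ (1 - q)) := by ring
          _ = _ := by rw [h8]
      have h10 : ((univ.filter fun v => edgeDist G v e ≤ (r : ℕ∞)).card : ℝ) * τ ≤
          2 * (L * D) * D ^ r * τ := by
        refine mul_le_mul_of_nonneg_right ((hball e he).trans ?_) hτ0.le
        exact mul_le_mul_of_nonneg_right (by linarith) hDr.le
      calc _ ≤ 2 * ((C * edgeNorm N f e) * (2 * (L * D) * D ^ r * τ + 5 * (L * D) * D ^ r * τ)) := by
            have hC0 : 0 ≤ C := by linarith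
            have hY := mul_le_mul_of_nonneg_left h6 hC0
            have hY0 : 0 ≤ C * edgeNorm N f e := mul_nonneg hC0 (hen e)
            refine mul_le_mul_of_nonneg_left ?_ (by norm_num)
            exact mul_le_mul hY (add_le_add h10 h7) (add_nonneg (mul_nonneg (Nat.cast_nonneg _) hτ0.le)
              (mul_nonneg (Nat.cast_nonneg _) h9.le)) hY0
        _ = _ := by ring
    have hfin := hstep.trans (sum_le_sum hedge)
    rw [← mul_sum, ← hEs, hthr', hτρ] at hfin
    have hfin' : ∑ v, N (chi (J v)) ≤ 28 * (L * D) * C / c * ρ ^ r * Es := by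
      refine le_of_mul_le_mul_left (hfin.trans (le_of_eq ?_))
        (show 0 < c * ρ ^ r * D ^ r / 2 by positivity)
      field_simp
      ring
    refine hfin'.trans ?_
    have hC0 : 0 ≤ C := by linarith
    have hL0 : 0 ≤ L := by linarith
    have hc2 : c ^ 2 ≤ c := pow_le_of_le_one hc0.le hc1 two_ne_zero
    have hDd' : D ≤ d := by linarith
    calc 28 * (L * D) * C / c * ρ ^ r * Es ≤ 28 * (L * d) * C / c ^ 2 * ρ ^ r * Es := by
          gcongr
      _ = _ := by ring
  · -- bad case
    have hstep : thr * ∑ v, N (chi (J v)) ≤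
        ∑ e ∈ G.edgeFinset, ∑ v ∈ univ.filter (fun v => edgeDist G v e ≤ (r : ℕ∞)),
          N (chi ((J v).filter fun j => auxJump f j e)) := by
      rw [← aux_swap G.edgeFinset (fun v e => edgeDist G v e ≤ (r : ℕ∞)), mul_sum]
      refine sum_le_sum fun v _ => ?_
      refine aux_core hN hunc _ (fun e => (J v).filter fun j => auxJump f j e)
        (J v) thr (by linarith) fun j hj => ?_
      refine (hcnt v j hj).trans ?_
      refine Nat.cast_le.2 (card_le_card fun e he => ?_)
      simp only [mem_filter] at he ⊢
      tauto
    have hedge : ∀ e ∈ G.edgeFinset,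
        ∑ v ∈ univ.filter (fun v => edgeDist G v e ≤ (r : ℕ∞)),
          N (chi ((J v).filter fun j => auxJump f j e)) ≤ 4 * D ^ r * edgeNorm N f e := by
      intro e he
      calc _ ≤ ∑ v ∈ univ.filter (fun v => edgeDist G v e ≤ (r : ℕ∞)), edgeNorm N f e := by
            refine sum_le_sum fun v _ => ?_
            refine le_trans (aux_chi_mono hN hunc _ _ ?_) (aux_edgeNorm hN hunc f hval e)
            intro j hj
            exact mem_filter.2 ⟨mem_univ _, (mem_filter.1 hj).2⟩
        _ = ((univ.filter fun v => edgeDist G v e ≤ (r : ℕ∞)).card : ℝ) * edgeNorm N f e := by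
            rw [sum_const, nsmul_eq_mul]
        _ ≤ _ := mul_le_mul_of_nonneg_right (hball e he) (hen e)
    have hfin := hstep.trans (sum_le_sum hedge)
    rw [← mul_sum, ← hEs, hthr'] at hfin
    have hfin' : ∑ v, N (chi (J v)) ≤ 4 / (c * ρ ^ r) * Es := by
      refine le_of_mul_le_mul_left (hfin.trans (le_of_eq ?_))
        (show 0 < c * ρ ^ r * D ^ r by positivity)
      field_simp
    have hτq : τ ^ q ≤ τ ^ 2 := by
      rw [← Real.rpow_natCast τ 2]
      exact Real.rpow_le_rpow_of_exponent_ge hτ0 hτ1 (by norm_num; exact hq)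
    have hb : c * ρ ^ r * D ^ r ≤ 2 * (L * D) * D ^ r * τ ^ 2 := by
      have h1 : L * Λ ≤ L * (D * D ^ r * τ ^ 2) := by
        refine mul_le_mul_of_nonneg_left (hlam.trans ?_) (by linarith)
        gcongr
      rw [hthr'] at hbad
      linarith
    have hb' : c ≤ 2 * (L * D) * ρ ^ r * ρ ^ r := by
      have h2 : c * (ρ ^ r * D ^ r) ≤ (2 * (L * D) * (ρ ^ r) ^ 3) * (ρ ^ r * D ^ r) := by
        rw [hτρ] at hb
        linarith
      have h3 := le_of_mul_le_mul_right h2 (by positivity)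
      refine h3.trans ?_
      have : (ρ ^ r) ^ 3 ≤ ρ ^ r * ρ ^ r := by
        have : 0 ≤ ρ ^ r * ρ ^ r * (1 - ρ ^ r) := by
          have : 0 ≤ 1 - ρ ^ r := by linarith
          positivity
        linarith
      calc 2 * (L * D) * (ρ ^ r) ^ 3 ≤ 2 * (L * D) * (ρ ^ r * ρ ^ r) := by gcongr
        _ = _ := by ring
    refine hfin'.trans (mul_le_mul_of_nonneg_right ?_ hEs0)
    rw [div_le_iff₀ (by positivity)]
    have e1 : 28 * L * d * C / c ^ 2 * ρ ^ r * (c * ρ ^ r) =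
      28 * (L * d * (ρ ^ r * ρ ^ r)) * C / c := by field_simp
    rw [e1, le_div_iff₀ hc0]
    have h5 : 0 < L * D * (ρ ^ r * ρ ^ r) := by positivity
    have h6 : L * D * (ρ ^ r * ρ ^ r) ≤ L * d * (ρ ^ r * ρ ^ r) := by
      gcongr
      linarith
    have h7 := mul_le_mul_of_nonneg_left hC (h5.le.trans h6)
    linarith

/-- Theorem 3.2: the Poincaré inequality for maps with values in `{-1, 0, 1}^k`. -/
theorem stmt_4 {n d k : ℕ} (q C α ε L : ℝ)
    (hq : 2 ≤ q) (hC : 1 ≤ C) (hd : 3 ≤ d)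
    (hα : 0 < α ∧ α ≤ 1) (hε : 0 < ε ∧ ε ≤ 1) (hL : 1 ≤ L)
    (G : SimpleGraph (Fin n)) [DecidableRel G.Adj]
    (hreg : ∀ v, G.degree v = d)
    (hExp : Expan n d G α ε L)
    (hk : 1 ≤ k) (N : (Fin k → ℝ) → ℝ)
    (hN : IsNorm k N) (hunc : OneUnconditional k N)
    (f : Fin n → Fin k → ℝ)
    (hval : ∀ v j, f v j = -1 ∨ f v j = 0 ∨ f v j = 1)
    (hnz : ∃ v, f v ≠ 0)
    (hmed : ∀ j, (n : ℝ) / 2 ≤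
      min ((univ.filter fun v => 0 ≤ f v j).card : ℝ)
        ((univ.filter fun v => f v j ≤ 0).card : ℝ))
    (hrc : RestrictedCotype k N q C
      {y | ∃ (v : Fin n) (J : Finset (Fin k)), y = proj J fun j => |f v j|}) :
    ∑ v, N (f v) ≤
      2 ^ 113 * q ^ 10 * C ^ 2 * ((d : ℝ) ^ 24 * L ^ 8 / (α ^ 14 * ε ^ 18)) *
        ∑ e ∈ G.edgeFinset, edgeNorm N f e := by
  have hα0 := hα.1
  have hα1 := hα.2
  have hε0 := hε.1
  have hε1 := hε.2
  have hd' : (3 : ℝ) ≤ d := by exact_mod_cast hd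
  have hD : (2 : ℝ) ≤ (d : ℝ) - 1 := by linarith
  obtain ⟨ρ, hρ⟩ : ∃ ρ : ℝ, ρ = 1 - ε / (2 * q * d) := ⟨_, rfl⟩
  have hx0 : 0 < ε / (2 * q * d) := by positivity
  have hx1 : ε / (2 * q * d) < 1 := by
    rw [div_lt_one (by positivity)]; nlinarith
  have hρ0 : 0 < ρ := by rw [hρ]; linarith
  have hρ1 : ρ < 1 := by rw [hρ]; linarith
  obtain ⟨hA, hB⟩ := hExp
  have hJjump : ∀ (j : Fin k) (s : ℝ) (a b : Fin n), G.Adj a b →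
      a ∈ univ.filter (fun v => f v j = s) → b ∉ univ.filter (fun v => f v j = s) →
      s(a, b) ∈ G.edgeFinset.filter fun e => auxJump f j e := by
    intro j s a b hab ha hb
    simp only [mem_filter, mem_univ, true_and] at ha hb
    rw [mem_filter]
    refine ⟨by simpa using hab, ?_⟩
    change f a j ≠ f b j
    intro h
    exact hb (h ▸ ha)
  -- the scales
  have hlv : ∀ v j, ∃ r : ℕ, f v j ≠ 0 →
      (α / 12 * (1 - ρ) * (ρ * ((d : ℝ) - 1)) ^ r ≤
        (((G.edgeFinset.filter fun e => auxJump f j e).filter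
          fun e => edgeDist G v e ≤ (r : ℕ∞)).card : ℝ)) ∧
      ∀ i < r, (((G.edgeFinset.filter fun e => auxJump f j e).filter
          fun e => edgeDist G v e ≤ (i : ℕ∞)).card : ℝ) ≤
        α / 12 * (1 - ρ) * (ρ * ((d : ℝ) - 1)) ^ i := by
    intro v j
    by_cases h0 : f v j = 0
    · exact ⟨0, fun h => absurd h0 h⟩
    have hex : ∃ r : ℕ, α / 12 * (1 - ρ) * (ρ * ((d : ℝ) - 1)) ^ r ≤
        (((G.edgeFinset.filter fun e => auxJump f j e).filter
          fun e => edgeDist G v e ≤ (r : ℕ∞)).card : ℝ) := by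
      by_contra hcon
      push Not at hcon
      obtain ⟨m, hm⟩ := pow_unbounded_of_one_lt (3 * (n : ℝ) / 4 / α)
        (show (1 : ℝ) < (d : ℝ) - 1 by linarith)
      have := aux_expand hd G hreg α ρ hα0 hα1 hρ0 hρ1 hA (univ.filter fun u => f u j = f v j)
        (aux_half f hmed j _ h0) (G.edgeFinset.filter fun e => auxJump f j e)
        (filter_subset _ _) (hJjump j _) {v} (singleton_nonempty v)
        (by intro u hu; rw [mem_singleton] at hu; subst hu; simp) m
        (by
          intro i _ u hu
          rw [mem_singleton] at hu; subst hu
          exact (hcon i).le)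
      rw [div_lt_iff₀ hα0] at hm
      simp only [card_singleton, Nat.cast_one, mul_one] at this
      linarith
    refine ⟨Nat.find hex, fun _ => ⟨Nat.find_spec hex, fun i hi => ?_⟩⟩
    have := Nat.find_min hex hi
    push Not at this
    exact this.le
  choose lv hlv using hlv
  have hpeel : ∀ (r : ℕ) (j : Fin k) (s : ℝ), ∃ Et : Fin n → Finset (Sym2 (Fin n)), s ≠ 0 →
      (∀ v ∈ univ.filter (fun v => f v j = s ∧ lv v j = r),
        ((G.edgeFinset.filter fun e =>
          edgeDist G v e ≤ (r : ℕ∞) ∧ e ∉ Et v).card : ℝ) ≤ L * ((d : ℝ) - 1 - ε) ^ (r + 1)) ∧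
      ∀ e, (((univ.filter (fun v => f v j = s ∧ lv v j = r)).filter fun v => e ∈ Et v).card : ℝ) ≤
        L * ((d : ℝ) - 1 - ε) ^ (r + 1) := by
    intro r j s
    by_cases hs : s = 0
    · exact ⟨fun _ => ∅, fun h => absurd hs h⟩
    obtain ⟨Et, h1, _, h3⟩ := aux_peel G.edgeFinset (fun v e => edgeDist G v e ≤ (r : ℕ∞))
      (L * ((d : ℝ) - 1 - ε) ^ (r + 1))
      (mul_nonneg (by linarith) (pow_nonneg (by linarith) _)) _
      (univ.filter (fun v => f v j = s ∧ lv v j = r)) rfl (by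
        intro S hS hSne
        have hb := hB S hSne (r + 1) (by omega) (by
          have := aux_expand hd G hreg α ρ hα0 hα1 hρ0 hρ1 hA (univ.filter fun u => f u j = s)
            (aux_half f hmed j _ hs) (G.edgeFinset.filter fun e => auxJump f j e)
            (filter_subset _ _) (hJjump j _) S hSne
            (by
              intro u hu
              have := (mem_filter.1 (hS hu)).2.1
              exact mem_filter.2 ⟨mem_univ _, this⟩) r
            (by
              intro i hi u hu
              obtain ⟨_, hu1, hu2⟩ := mem_filter.1 (hS hu)
              exact (hlv u j (by rw [hu1]; exact hs)).2 i (by rw [hu2]; exact hi))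
          simpa using this.le)
        simp only [Nat.add_sub_cancel] at hb
        convert hb)
    refine ⟨Et, fun _ => ⟨fun v hv => ?_, fun e => ?_⟩⟩
    · convert h1 v hv
    · convert h3 e
  choose Et hEt using hpeel
  let J : ℕ → Fin n → Finset (Fin k) := fun r v =>
    univ.filter fun j => f v j ≠ 0 ∧ lv v j = r
  have hscale : ∀ r, ∑ v, N (chi (J r v)) ≤
      28 * L * d * C / ((α / 12) ^ 2 * (1 - ρ) ^ 2) * ρ ^ r *
      ∑ e ∈ G.edgeFinset, edgeNorm N f e := by
    intro r
    refine aux_scale q C α ε L hq hC hd hα hε hL G hreg N hN hunc f hval hrc ρ hρ hρ0 hρ1 r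
      (J r) (fun v j hj => (mem_filter.1 hj).2.1) ?_ (fun j v => Et r j (f v j) v) ?_ ?_
    · intro v j hj
      obtain ⟨_, h1, h2⟩ := mem_filter.1 hj
      have := (hlv v j h1).1
      rw [h2] at this
      exact this
    · intro v j hj
      obtain ⟨_, h1, h2⟩ := mem_filter.1 hj
      exact (hEt r j (f v j) h1).1 v (mem_filter.2 ⟨mem_univ _, rfl, h2⟩)
    · intro j e
      have h1 := (hEt r j 1 (by norm_num)).2 e
      have h2 := (hEt r j (-1) (by norm_num)).2 e
      have hsub : (univ.filter fun v => j ∈ J r v ∧ e ∈ Et r j (f v j) v) ⊆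
          ((univ.filter (fun v => f v j = 1 ∧ lv v j = r)).filter fun v => e ∈ Et r j 1 v) ∪
          ((univ.filter (fun v => f v j = -1 ∧ lv v j = r)).filter fun v => e ∈ Et r j (-1) v) := by
        intro v hv
        obtain ⟨_, hv1, hv2⟩ := mem_filter.1 hv
        obtain ⟨_, hv3, hv4⟩ := mem_filter.1 hv1
        rw [mem_union, mem_filter, mem_filter, mem_filter, mem_filter]
        rcases hval v j with h | h | h
        · right
          rw [h] at hv2
          exact ⟨⟨mem_univ _, h, hv4⟩, hv2⟩
        · exact absurd h hv3
        · left
          rw [h] at hv2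
          exact ⟨⟨mem_univ _, h, hv4⟩, hv2⟩
      have h3 : ((univ.filter fun v => j ∈ J r v ∧ e ∈ Et r j (f v j) v).card : ℝ) ≤
          (((univ.filter (fun v => f v j = 1 ∧ lv v j = r)).filter
            fun v => e ∈ Et r j 1 v).card : ℝ) +
          (((univ.filter (fun v => f v j = -1 ∧ lv v j = r)).filter
            fun v => e ∈ Et r j (-1) v).card : ℝ) := by
        exact_mod_cast (card_le_card hsub).trans (card_union_le _ _)
      linarith
  obtain ⟨R, hR⟩ : ∃ R : ℕ, ∀ v j, lv v j < R := by
    refine ⟨∑ v, ∑ j, lv v j + 1, fun v j => Nat.lt_succ_of_le ?_⟩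
    calc lv v j ≤ ∑ j, lv v j := single_le_sum (f := fun j => lv v j) (fun _ _ => Nat.zero_le _)
          (mem_univ j)
      _ ≤ ∑ v, ∑ j, lv v j :=
          single_le_sum (f := fun v => ∑ j, lv v j) (fun _ _ => Nat.zero_le _) (mem_univ v)
  have hdecomp : ∀ v, N (f v) ≤ ∑ r ∈ range R, N (chi (J r v)) := by
    intro v
    refine le_trans (aux_mono hN hunc _ _ fun j => ?_) (aux_N_sum hN _ _)
    rw [Finset.sum_apply]
    by_cases h0 : f v j = 0
    · rw [h0]; simp
    · have h1 : (1 : ℝ) ≤ ∑ r ∈ range R, chi (J r v) j := by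
        have h2 : chi (J (lv v j) v) j = 1 := by simp [chi, J, h0]
        rw [← h2]
        refine single_le_sum (f := fun r => chi (J r v) j) (fun r _ => ?_)
          (mem_range.2 (hR v j))
        simp only [chi]
        split_ifs <;> norm_num
      refine le_trans ?_ (h1.trans (le_abs_self _))
      rcases hval v j with h | h | h <;> rw [h] <;> norm_num
  have hen : ∀ e, 0 ≤ edgeNorm N f e := fun e =>
    (aux_N_nonneg hN _).trans (aux_edgeNorm hN hunc f hval e)
  have hEs0 : 0 ≤ ∑ e ∈ G.edgeFinset, edgeNorm N f e := sum_nonneg fun e _ => hen e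
  have h1ρ : 1 - ρ = ε / (2 * q * d) := by rw [hρ]; ring
  calc ∑ v, N (f v) ≤ ∑ v, ∑ r ∈ range R, N (chi (J r v)) := sum_le_sum fun v _ => hdecomp v
    _ = ∑ r ∈ range R, ∑ v, N (chi (J r v)) := sum_comm
    _ ≤ ∑ r ∈ range R, 28 * L * d * C / ((α / 12) ^ 2 * (1 - ρ) ^ 2) * ρ ^ r *
          ∑ e ∈ G.edgeFinset, edgeNorm N f e := sum_le_sum fun r _ => hscale r
    _ = 28 * L * d * C / ((α / 12) ^ 2 * (1 - ρ) ^ 2) * (∑ r ∈ range R, ρ ^ r) *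
          ∑ e ∈ G.edgeFinset, edgeNorm N f e := by
        rw [mul_sum (range R), sum_mul (range R)]
    _ ≤ 28 * L * d * C / ((α / 12) ^ 2 * (1 - ρ) ^ 2) * (1 / (1 - ρ)) *
          ∑ e ∈ G.edgeFinset, edgeNorm N f e := by
        refine mul_le_mul_of_nonneg_right ?_ hEs0
        refine mul_le_mul_of_nonneg_left (aux_geom ρ hρ0 hρ1 R) ?_
        have hC0 : 0 ≤ C := by linarith
        have hL0 : 0 ≤ L := by linarith
        positivity
    _ ≤ _ := by
        refine mul_le_mul_of_nonneg_right ?_ hEs0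
        rw [h1ρ]
        exact aux_final q C α ε L d hq hC hd' hα0 hα1 hε0 hε1 hL
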